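/- Assume α_x and α_y are coprime and α_y ≥ 3. Let s₁ = (0,1,0), s₂ = (0,5,0), s₀ = (0,3,0) in A, and let n_xy be the least positive integer n with n·α_x ≡ 1 (mod α_y). Define the diagonal chains D_z^{++} = {s₀ + e_x^+ + λ(e_x^+ + e_y^+) : 0 ≤ λ < 2·α_x·n_xy} and D_z^{+-} = {s₀ + e_x^+ + λ(e_x^+ + e_y^-) : 0 ≤ λ < 2·α_x·n_xy}, and let P = Z|_{D_z^{++}} + Z|_{D_z^{+-}} (componentwise sum over ZMod 2, so P^X = 0). Then for every s ∈ A \ D, ω(S_s, P) = 1 if and only if s ∈ {s₁, s₂}. -/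

import Mathlib

namespace Chamon

/-- Ambient group `A = ZMod (2αx) × ZMod (2αy) × ZMod (2αz)`. -/
abbrev Amb (ax ay az : ℕ) : Type :=
  ZMod (2 * ax) × ZMod (2 * ay) × ZMod (2 * az)

/-- Reduction mod 2 of a coordinate. -/
def par {n : ℕ} (a : ZMod (2 * n)) : ZMod 2 :=
  ZMod.castHom (dvd_mul_right 2 n) (ZMod 2) a

variable (ax ay az : ℕ)

def ex : Amb ax ay az := (1, 0, 0)
def ey : Amb ax ay az := (0, 1, 0)
def ez : Amb ax ay az := (0, 0, 1)

/-- The data-qubit set `D`. -/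
def dataSet : Set (Amb ax ay az) :=
  {a | par a.1 + par a.2.1 + par a.2.2 = 0}

/-- A Pauli operator (modulo phase): a pair of functions `D → ZMod 2`. -/
abbrev Pauli : Type :=
  (↥(dataSet ax ay az) → ZMod 2) × (↥(dataSet ax ay az) → ZMod 2)

/-- The stabilizer generator `S_s`. -/
def stab (s : Amb ax ay az) : Pauli ax ay az :=
  (fun d =>
      (if (d : Amb ax ay az) = s + ex ax ay az then 1 else 0) +
      (if (d : Amb ax ay az) = s - ex ax ay az then 1 else 0) +
      (if (d : Amb ax ay az) = s + ey ax ay az then 1 else 0) +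
      (if (d : Amb ax ay az) = s - ey ax ay az then 1 else 0),
   fun d =>
      (if (d : Amb ax ay az) = s + ez ax ay az then 1 else 0) +
      (if (d : Amb ax ay az) = s - ez ax ay az then 1 else 0) +
      (if (d : Amb ax ay az) = s + ey ax ay az then 1 else 0) +
      (if (d : Amb ax ay az) = s - ey ax ay az then 1 else 0))

/-- The symplectic form `ω(P,Q)`. -/
noncomputable def sympl (P Q : Pauli ax ay az) : ZMod 2 :=
  ∑ᶠ d : ↥(dataSet ax ay az), (P.1 d * Q.2 d + P.2 d * Q.1 d)

/-- `X|_E`: X-part is the indicator of `E`, Z-part is zero. -/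
noncomputable def Xop (E : Set (Amb ax ay az)) : Pauli ax ay az :=
  (fun d => E.indicator (fun _ => (1 : ZMod 2)) (d : Amb ax ay az), fun _ => 0)

/-- `Z|_E`: Z-part is the indicator of `E`, X-part is zero. -/
noncomputable def Zop (E : Set (Amb ax ay az)) : Pauli ax ay az :=
  (fun _ => 0, fun d => E.indicator (fun _ => (1 : ZMod 2)) (d : Amb ax ay az))

/-- The `ZMod 2`-linear span `𝒮` of the stabilizer generators. -/
def stabSpan : Submodule (ZMod 2) (Pauli ax ay az) :=
  Submodule.span (ZMod 2) (stab ax ay az '' (dataSet ax ay az)ᶜ)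

/-- The four generating points `g₀, g₁, g₂, g₃`. -/
def gpt : Fin 4 → Amb ax ay az := ![(0,0,0), (1,1,0), (1,0,1), (0,1,1)]

/-- Half-plane support `D_x^g` (parallel to the `yOz` plane). -/
def Dxg (g : Amb ax ay az) : Set (Amb ax ay az) :=
  {d | ∃ l m : ℤ, d = g + (2*l) • ez ax ay az + (2*m) • ey ax ay az}

/-- Half-plane support `D_z^g` (parallel to the `xOy` plane). -/
def Dzg (g : Amb ax ay az) : Set (Amb ax ay az) :=
  {d | ∃ l m : ℤ, d = g + (2*l) • ex ax ay az + (2*m) • ey ax ay az}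

end Chamon


open Chamon

section Chain

variable {G : Type*} [AddCommGroup G] [DecidableEq G]

/-- Over `ZMod 2`, a sum of consecutive pairs telescopes to its two ends. -/
lemma sum_range_add_succ_zmod_two (F : ℕ → ZMod 2) (L : ℕ) :
    ∑ k ∈ Finset.range L, (F k + F (k + 1)) = F 0 + F L := by
  induction L with
  | zero => simp [CharTwo.add_self_eq_zero]
  | succ L ih =>
    rw [Finset.sum_range_succ, ih]
    linear_combination CharTwo.add_self_eq_zero (F L)

/-- The indicator of a chain without self-intersections is the sum of the indicators of its
points. -/
lemma indicator_chain (g v : G) (L : ℕ) (hL : L ≤ addOrderOf v) (d : G) :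
    Set.indicator {d | ∃ l : ℤ, 0 ≤ l ∧ l < (L : ℤ) ∧ d = g + l • v}
        (fun _ => (1 : ZMod 2)) d =
      ∑ k ∈ Finset.range L, if d = g + k • v then 1 else 0 := by
  by_cases h : ∃ k ∈ Finset.range L, d = g + k • v
  · obtain ⟨k, hk, rfl⟩ := h
    rw [Set.indicator_of_mem, Finset.sum_eq_single_of_mem k hk, if_pos rfl]
    · intro j hj hjk
      refine if_neg fun h => hjk ?_
      rw [Finset.mem_range] at hj hk
      exact (nsmul_injOn_Iio_addOrderOf (Set.mem_Iio.2 (hk.trans_le hL))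
        (Set.mem_Iio.2 (hj.trans_le hL)) (add_left_cancel h)).symm
    · rw [Finset.mem_range] at hk
      exact ⟨k, by positivity, by exact_mod_cast hk, by simp⟩
  · rw [Set.indicator_of_notMem, Finset.sum_eq_zero]
    · exact fun k hk => if_neg fun hd => h ⟨k, hk, hd⟩
    · rintro ⟨l, hl0, hlL, hd⟩
      lift l to ℕ using hl0
      exact h ⟨l, Finset.mem_range.2 (by exact_mod_cast hlL), by simpa using hd⟩

/-- The sum of the indicator of a diagonal chain over the four neighbours of `s` only sees the
two ends of the chain. -/
lemma chain_neighbour_sum (g a b s : G) (L : ℕ) (hL : L ≤ addOrderOf (a + b))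
    (f : G → ZMod 2)
    (hf : f = Set.indicator {d | ∃ l : ℤ, 0 ≤ l ∧ l < (L : ℤ) ∧ d = g + l • (a + b)}
        (fun _ => (1 : ZMod 2))) :
    f (s + a) + f (s - a) + f (s + b) + f (s - b) =
      ((if s = g - a then 1 else 0) + (if s = g - b then 1 else 0)) +
      ((if s = g + L • (a + b) - a then 1 else 0) +
        (if s = g + L • (a + b) - b then 1 else 0)) := by
  have key := sum_range_add_succ_zmod_two
    (fun k => (if s = g + k • (a + b) - a then 1 else 0) +
      (if s = g + k • (a + b) - b then 1 else 0)) L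
  simp only [zero_smul, add_zero] at key
  rw [← key, hf]
  simp only [indicator_chain g (a + b) L hL, ← Finset.sum_add_distrib]
  refine Finset.sum_congr rfl fun k _ => ?_
  have h1 : s + a = g + k • (a + b) ↔ s = g + k • (a + b) - a := eq_sub_iff_add_eq.symm
  have h2 : s + b = g + k • (a + b) ↔ s = g + k • (a + b) - b := eq_sub_iff_add_eq.symm
  have h3 : s - a = g + k • (a + b) ↔ s = g + (k + 1) • (a + b) - b := by
    rw [sub_eq_iff_eq_add, succ_nsmul]
    constructor <;> rintro rfl <;> abel
  have h4 : s - b = g + k • (a + b) ↔ s = g + (k + 1) • (a + b) - a := by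
    rw [sub_eq_iff_eq_add, succ_nsmul]
    constructor <;> rintro rfl <;> abel
  simp only [h1, h2, h3, h4]
  ring

end Chain

namespace Chamon

variable {ax ay az : ℕ}

lemma par_add {n : ℕ} (a b : ZMod (2 * n)) : par (a + b) = par a + par b := map_add _ a b

lemma par_one {n : ℕ} : par (1 : ZMod (2 * n)) = 1 := map_one _

lemma par_zero {n : ℕ} : par (0 : ZMod (2 * n)) = 0 := map_zero _

lemma par_sub {n : ℕ} (a b : ZMod (2 * n)) : par (a - b) = par a - par b := map_sub _ a b

/-- A step of odd parity leads from a stabilizer site to data qubits. -/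
lemma neighbour_mem {s e : Amb ax ay az} (hs : s ∉ dataSet ax ay az)
    (he : par e.1 + par e.2.1 + par e.2.2 = 1) :
    s + e ∈ dataSet ax ay az ∧ s - e ∈ dataSet ax ay az := by
  simp only [dataSet, Set.mem_ofPred_eq, Prod.fst_add, Prod.snd_add, Prod.fst_sub, Prod.snd_sub,
    par_add, par_sub] at hs ⊢
  have hs1 : par s.1 + par s.2.1 + par s.2.2 = 1 := by
    generalize par s.1 + par s.2.1 + par s.2.2 = t at hs
    revert t; decide
  have h2 : (1 + 1 : ZMod 2) = 0 := rfl
  constructor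
  · linear_combination hs1 + he + h2
  · linear_combination hs1 - he

/-- The syndrome at `s` of a `Z`-type operator is the sum of its `Z`-part over the four
horizontal neighbours of `s`. -/
lemma sympl_stab_Z [NeZero ax] [NeZero ay] [NeZero az] {s : Amb ax ay az}
    (hs : s ∉ dataSet ax ay az) (f : Amb ax ay az → ZMod 2) :
    sympl ax ay az (stab ax ay az s) (fun _ => 0, fun d => f d) =
      f (s + ex ax ay az) + f (s - ex ax ay az) + f (s + ey ax ay az) + f (s - ey ax ay az) := by
  classical
  obtain ⟨hx, hx'⟩ := neighbour_mem (e := ex ax ay az) hs (by simp [ex, par_one, par_zero])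
  obtain ⟨hy, hy'⟩ := neighbour_mem (e := ey ax ay az) hs (by simp [ey, par_one, par_zero])
  have single : ∀ t ∈ dataSet ax ay az,
      ∑ d : dataSet ax ay az, (if (d : Amb ax ay az) = t then 1 else 0) * f d = f t := by
    intro t ht
    rw [Finset.sum_eq_single_of_mem ⟨t, ht⟩ (Finset.mem_univ _)]
    · simp
    · intro d _ hd
      rw [if_neg fun h => hd (Subtype.ext h), zero_mul]
  rw [sympl, finsum_eq_sum_of_fintype]
  simp only [stab, mul_zero, add_zero, add_mul, Finset.sum_add_distrib]
  rw [← single _ hx, ← single _ hx', ← single _ hy, ← single _ hy']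

/-- A direction with horizontal part `(1, ±1)` has order at least `2 αx αy` when `αx` and `αy`
are coprime. -/
lemma le_addOrderOf_diagonal [NeZero ax] [NeZero ay] [NeZero az] (hco : Nat.Coprime ax ay)
    (v : Amb ax ay az) (hx : v.1 = 1) (hy : v.2.1 = 1 ∨ v.2.1 = -1) :
    2 * ax * ay ≤ addOrderOf v := by
  have hpos : 0 < addOrderOf v := addOrderOf_pos v
  have h0 := addOrderOf_nsmul_eq_zero v
  generalize addOrderOf v = n at hpos h0
  have h1 : (n : ZMod (2 * ax)) = 0 := by
    simpa [hx] using congrArg Prod.fst h0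
  have h2 : (n : ZMod (2 * ay)) = 0 := by
    have := congrArg (fun p => p.2.1) h0
    rcases hy with hy | hy <;> simpa [hy] using this
  rw [ZMod.natCast_eq_zero_iff] at h1 h2
  have h := Nat.lcm_dvd h1 h2
  rw [Nat.lcm_mul_left, hco.lcm_eq_mul, ← mul_assoc] at h
  exact Nat.le_of_dvd hpos h

end Chamon

/-- with `αx, αy` coprime, `αy ≥ 3`, `s₁ = (0,1,0)`, `s₂ = (0,5,0)`,
`s₀ = (0,3,0)` and `n_xy` the least positive `n` with `n·αx ≡ 1 (mod αy)`, the
product `P = Z|_{D_z^{++}} + Z|_{D_z^{+-}}` of the two diagonal chain Z operators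
has nontrivial syndrome exactly at `s₁` and `s₂`. -/
theorem chamon_diagonal_chain_syndrome (ax ay az : ℕ)
    (hax : 2 ≤ ax) (hay : 3 ≤ ay) (haz : 2 ≤ az)
    (hco : Nat.Coprime ax ay)
    (nxy : ℕ) (hpos : 0 < nxy) (hmod : nxy * ax ≡ 1 [MOD ay])
    (hmin : ∀ m : ℕ, 0 < m → m * ax ≡ 1 [MOD ay] → nxy ≤ m) :
    ∀ s ∉ dataSet ax ay az,
      (sympl ax ay az (stab ax ay az s)
        (Zop ax ay az
          {d | ∃ l : ℤ, 0 ≤ l ∧ l < 2 * (ax : ℤ) * (nxy : ℤ) ∧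
            d = ((0,3,0) : Amb ax ay az) + ex ax ay az
                + l • (ex ax ay az + ey ax ay az)} +
         Zop ax ay az
          {d | ∃ l : ℤ, 0 ≤ l ∧ l < 2 * (ax : ℤ) * (nxy : ℤ) ∧
            d = ((0,3,0) : Amb ax ay az) + ex ax ay az
                + l • (ex ax ay az - ey ax ay az)}) = 1 ↔
        s = ((0,1,0) : Amb ax ay az) ∨ s = ((0,5,0) : Amb ax ay az)) := by
  intro s hs
  have : NeZero ax := ⟨by omega⟩
  have : NeZero ay := ⟨by omega⟩
  have : NeZero az := ⟨by omega⟩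
  have hle : nxy ≤ ay := by
    by_contra! h
    have h' : (nxy - ay) * ax + ay * ax = nxy * ax := by
      rw [← add_mul, Nat.sub_add_cancel h.le]
    have := hmin (nxy - ay) (by omega) (by
      rw [← h'] at hmod
      simpa [Nat.ModEq] using hmod)
    omega
  have hL : 2 * ax * nxy ≤ 2 * ax * ay := Nat.mul_le_mul_left _ hle
  have hLx : ((2 * ax * nxy : ℕ) : ZMod (2 * ax)) = 0 :=
    (ZMod.natCast_eq_zero_iff _ _).2 (dvd_mul_right _ _)
  have hLy : ((2 * ax * nxy : ℕ) : ZMod (2 * ay)) = 2 := by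
    have : 2 * ax * nxy ≡ 2 [MOD 2 * ay] := by
      simpa [mul_assoc, mul_comm ax] using hmod.mul_left' 2
    exact_mod_cast (ZMod.natCast_eq_natCast_iff _ _ _).2 this
  have hplus := chain_neighbour_sum ((0,3,0) + ex ax ay az) (ex ax ay az) (ey ax ay az) s
    (2 * ax * nxy) (hL.trans (le_addOrderOf_diagonal hco _ (by simp [ex, ey])
      (by simp [ex, ey]))) _ rfl
  have hminus := chain_neighbour_sum ((0,3,0) + ex ax ay az) (ex ax ay az) (-ey ax ay az) s
    (2 * ax * nxy) (hL.trans (le_addOrderOf_diagonal hco _ (by simp [ex, ey])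
      (by simp [ex, ey]))) _ rfl
  have hends : ((0,3,0) + ex ax ay az + (2 * ax * nxy) • (ex ax ay az + ey ax ay az) :
      Amb ax ay az) = (1,5,0) := by
    simp only [ex, ey, Prod.mk_add_mk, Prod.smul_mk, nsmul_eq_mul, add_zero, zero_add, mul_one,
      mul_zero, hLx, hLy]
    norm_num
  have hends' : ((0,3,0) + ex ax ay az + (2 * ax * nxy) • (ex ax ay az + -ey ax ay az) :
      Amb ax ay az) = (1,1,0) := by
    simp only [ex, ey, Prod.mk_add_mk, Prod.neg_mk, Prod.smul_mk, nsmul_eq_mul, add_zero,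
      zero_add, mul_one, mul_zero, neg_zero, mul_neg, hLx, hLy]
    norm_num
  rw [hends] at hplus
  rw [hends'] at hminus
  have e1 : ((0,3,0) + ex ax ay az - ex ax ay az : Amb ax ay az) = (0,3,0) := by abel
  have e2 : ((0,3,0) + ex ax ay az - ey ax ay az : Amb ax ay az) = (1,2,0) := by
    simp [ex, ey]; norm_num
  have e3 : ((0,3,0) + ex ax ay az - -ey ax ay az : Amb ax ay az) = (1,4,0) := by
    simp [ex, ey]; norm_num
  have e4 : ((1,5,0) - ex ax ay az : Amb ax ay az) = (0,5,0) := by simp [ex]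
  have e5 : ((1,5,0) - ey ax ay az : Amb ax ay az) = (1,4,0) := by simp [ey]; norm_num
  have e6 : ((1,1,0) - ex ax ay az : Amb ax ay az) = (0,1,0) := by simp [ex]
  have e7 : ((1,1,0) - -ey ax ay az : Amb ax ay az) = (1,2,0) := by simp [ey]; norm_num
  rw [e1, e2, e4, e5] at hplus
  rw [e1, e3, e6, e7, ← sub_eq_add_neg, ← sub_eq_add_neg, sub_neg_eq_add] at hminus
  push_cast at hplus hminus
  have hZ := sympl_stab_Z hs (fun d =>
    Set.indicator {d | ∃ l : ℤ, 0 ≤ l ∧ l < 2 * (ax : ℤ) * (nxy : ℤ) ∧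
      d = ((0,3,0) : Amb ax ay az) + ex ax ay az + l • (ex ax ay az + ey ax ay az)}
      (fun _ => (1 : ZMod 2)) d +
    Set.indicator {d | ∃ l : ℤ, 0 ≤ l ∧ l < 2 * (ax : ℤ) * (nxy : ℤ) ∧
      d = ((0,3,0) : Amb ax ay az) + ex ax ay az + l • (ex ax ay az - ey ax ay az)}
      (fun _ => (1 : ZMod 2)) d)
  have hne : ((0,1,0) : Amb ax ay az) ≠ (0,5,0) := by
    intro h
    have h15 : ((1 : ℕ) : ZMod (2 * ay)) = (5 : ℕ) := by
      exact_mod_cast congrArg (fun p : Amb ax ay az => p.2.1) h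
    rw [ZMod.natCast_eq_natCast_iff] at h15
    have := Nat.le_of_dvd (by norm_num) ((Nat.modEq_iff_dvd' (by norm_num)).1 h15)
    omega
  replace hZ := hZ.trans (show _ =
      (if s = (0,1,0) then 1 else 0) + (if s = (0,5,0) then 1 else 0) by
    have h2 : (2 : ZMod 2) = 0 := rfl
    linear_combination hplus + hminus + h2 * ((if s = (0,3,0) then 1 else 0) +
      (if s = (1,2,0) then 1 else 0) + (if s = (1,4,0) then 1 else 0)))
  have hP : ∀ E F : Set (Amb ax ay az), Zop ax ay az E + Zop ax ay az F =
      ((fun _ => 0, fun d => E.indicator (fun _ => (1 : ZMod 2)) (d : Amb ax ay az) +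
        F.indicator (fun _ => (1 : ZMod 2)) (d : Amb ax ay az)) : Pauli ax ay az) := fun E F =>
    Prod.ext (funext fun _ => add_zero _) rfl
  rw [hP, hZ]
  by_cases h1 : s = (0,1,0)
  · simp [h1, hne]
  · by_cases h5 : s = (0,5,0)
    · rw [if_neg h1, if_pos h5]
      simp [h5]
    · simp [h1, h5]
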